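/- For α > 2 and a > 0, the improper integral ∫₀^∞ (1 − (1 + a·r^{−α})^{−1}) r dr converges and equals (π/α)·a^{2/α}·csc(2π/α). -/

import Mathlib

open MeasureTheory Real Set

lemma lintegral_rpow_mul_exp_neg_mul_Ioi {s r : ℝ} (hs : 0 < s) (hr : 0 < r) :
    ∫⁻ t in Ioi (0 : ℝ), ENNReal.ofReal (t ^ (s - 1) * exp (-(r * t))) =
      ENNReal.ofReal ((1 / r) ^ s * Gamma s) := by
  have h := integral_rpow_mul_exp_neg_mul_Ioi hs hr
  have hΓ := Gamma_pos_of_pos hs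
  have hint : IntegrableOn (fun t : ℝ => t ^ (s - 1) * exp (-(r * t))) (Ioi 0) := by
    refine not_imp_comm.1 integral_undef ?_
    rw [h]
    positivity
  rw [← h, ofReal_integral_eq_lintegral_ofReal hint]
  filter_upwards [ae_restrict_mem measurableSet_Ioi] with t ht
  have ht : 0 < t := ht
  positivity

lemma lintegral_rpow_div_one_add_Ioi {s : ℝ} (h0 : 0 < s) (h1 : s < 1) :
    ∫⁻ x in Ioi (0 : ℝ), ENNReal.ofReal (x ^ (s - 1) / (1 + x)) =
      ENNReal.ofReal (π / sin (π * s)) := by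
  have hexp (x : ℝ) (hx : x ∈ Ioi (0 : ℝ)) : ENNReal.ofReal (x ^ (s - 1) / (1 + x)) =
      ∫⁻ t in Ioi (0 : ℝ), ENNReal.ofReal (x ^ (s - 1) * exp (-((1 + x) * t))) := by
    have hx : 0 < x := hx
    have h := lintegral_rpow_mul_exp_neg_mul_Ioi one_pos (r := 1 + x) (by positivity)
    simp only [sub_self, rpow_zero, one_mul, rpow_one, Gamma_one, mul_one] at h
    simp only [ENNReal.ofReal_mul (rpow_nonneg hx.le (s - 1))]
    rw [lintegral_const_mul _ (by fun_prop), h, ← ENNReal.ofReal_mul (by positivity)]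
    congr 1
    ring
  have hgamma (t : ℝ) (ht : t ∈ Ioi (0 : ℝ)) :
      ∫⁻ x in Ioi (0 : ℝ), ENNReal.ofReal (x ^ (s - 1) * exp (-((1 + x) * t))) =
        ENNReal.ofReal (Gamma s) * ENNReal.ofReal (t ^ ((1 - s) - 1) * exp (-(1 * t))) := by
    have ht : 0 < t := ht
    have hsplit (x : ℝ) : ENNReal.ofReal (x ^ (s - 1) * exp (-((1 + x) * t))) =
        ENNReal.ofReal (exp (-t)) * ENNReal.ofReal (x ^ (s - 1) * exp (-(t * x))) := by
      rw [← ENNReal.ofReal_mul (exp_nonneg _), mul_left_comm, ← exp_add]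
      ring_nf
    simp only [hsplit]
    rw [lintegral_const_mul _ (by fun_prop), lintegral_rpow_mul_exp_neg_mul_Ioi h0 ht,
      ← ENNReal.ofReal_mul (exp_nonneg _),
      ← ENNReal.ofReal_mul (Gamma_pos_of_pos h0).le, one_div, inv_rpow ht.le, ← rpow_neg ht.le]
    ring_nf
  rw [setLIntegral_congr_fun measurableSet_Ioi hexp, lintegral_lintegral_swap (by fun_prop),
    setLIntegral_congr_fun measurableSet_Ioi hgamma, lintegral_const_mul _ (by fun_prop),
    lintegral_rpow_mul_exp_neg_mul_Ioi (sub_pos.2 h1) one_pos,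
    ← ENNReal.ofReal_mul (Gamma_pos_of_pos h0).le, ← Gamma_mul_Gamma_one_sub]
  simp

lemma integrableOn_rpow_div_one_add_Ioi {s : ℝ} (h0 : 0 < s) (h1 : s < 1) :
    IntegrableOn (fun x : ℝ => x ^ (s - 1) / (1 + x)) (Ioi 0) := by
  refine (lintegral_ofReal_ne_top_iff_integrable
    (Measurable.aestronglyMeasurable (by fun_prop)) ?_).1 ?_
  · filter_upwards [ae_restrict_mem measurableSet_Ioi] with x hx
    have hx : 0 < x := hx
    positivity
  · rw [lintegral_rpow_div_one_add_Ioi h0 h1]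
    exact ENNReal.ofReal_ne_top

lemma integral_rpow_div_one_add_Ioi {s : ℝ} (h0 : 0 < s) (h1 : s < 1) :
    ∫ x in Ioi (0 : ℝ), x ^ (s - 1) / (1 + x) = π / sin (π * s) := by
  rw [integral_eq_lintegral_of_nonneg_ae ?_ (Measurable.aestronglyMeasurable (by fun_prop)),
    lintegral_rpow_div_one_add_Ioi h0 h1,
    ENNReal.toReal_ofReal]
  · rw [← Gamma_mul_Gamma_one_sub]
    exact (mul_pos (Gamma_pos_of_pos h0) (Gamma_pos_of_pos (sub_pos.2 h1))).le
  · filter_upwards [ae_restrict_mem measurableSet_Ioi] with x hx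
    have hx : 0 < x := hx
    positivity

theorem radial_integral_closed_form (α a : ℝ) (hα : 2 < α) (ha : 0 < a) :
    IntegrableOn (fun r : ℝ => (1 - (1 + a * r ^ (-α))⁻¹) * r) (Set.Ioi 0) volume ∧
    ∫ r in Set.Ioi (0 : ℝ), (1 - (1 + a * r ^ (-α))⁻¹) * r =
      (Real.pi / α) * a ^ (2 / α) * (Real.sin (2 * Real.pi / α))⁻¹ := by
  have hα0 : 0 < α := by linarith
  have hs0 : 0 < 1 - 2 / α := by rw [sub_pos, div_lt_one hα0]; exact hα
  have hs1 : 1 - 2 / α < 1 := by rw [sub_lt_self_iff]; positivity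
  set h : ℝ → ℝ := fun x => x ^ ((1 - 2 / α) - 1) / (1 + x)
  have hh : IntegrableOn h (Ioi 0) := integrableOn_rpow_div_one_add_Ioi hs0 hs1
  have hI : ∫ x in Ioi (0 : ℝ), h x = π / sin (π * (1 - 2 / α)) :=
    integral_rpow_div_one_add_Ioi hs0 hs1
  set g : ℝ → ℝ := fun y => a ^ (1 + 2 / α) / α * h (a * y)
  have hsubst (r : ℝ) (hr : r ∈ Ioi (0 : ℝ)) :
      (1 - (1 + a * r ^ (-α))⁻¹) * r = (|-α| * r ^ (-α - 1)) • g (r ^ (-α)) := by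
    have hr : 0 < r := hr
    have hp : 0 < r ^ (-α) := rpow_pos_of_pos hr _
    have h2 : (r ^ (-α)) ^ (-(2 / α)) = r ^ 2 := by
      rw [← rpow_mul hr.le, ← rpow_two]
      congr 1
      field_simp
    have h3 : a ^ (2 / α) ≠ 0 := (rpow_pos_of_pos ha _).ne'
    simp only [g, h, abs_neg, abs_of_pos hα0, smul_eq_mul]
    rw [show 1 - 2 / α - 1 = -(2 / α) by ring, mul_rpow ha.le hp.le, h2, rpow_add ha, rpow_one,
      rpow_sub_one hr.ne', rpow_neg ha.le]
    field_simp
    ring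
  have hg : IntegrableOn g (Ioi 0) := by
    have := (integrableOn_Ioi_comp_mul_left_iff h 0 ha).2 (by simpa using hh)
    exact this.const_mul _
  constructor
  · exact ((integrableOn_Ioi_comp_rpow_iff g (neg_ne_zero.2 hα0.ne')).2 hg).congr_fun
      (fun r hr => (hsubst r hr).symm) measurableSet_Ioi
  · rw [setIntegral_congr_fun measurableSet_Ioi hsubst,
      integral_comp_rpow_Ioi g (neg_ne_zero.2 hα0.ne'), integral_const_mul,
      integral_comp_mul_left_Ioi h 0 ha, mul_zero, hI, mul_sub, mul_one, sin_pi_sub,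
      rpow_add ha, rpow_one, smul_eq_mul, show π * (2 / α) = 2 * π / α by ring]
    field_simp
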